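/- arXiv:2602.03455 — 2 statements merged into one kernel-verified Lean document; each statement's English description precedes it below -/
import Mathlib

section
/- The total cost is an exact potential function for CC-MAR: for every strategy profile P = (P_1, …, P_k), every agent i, and every alternative s_i–t_i path P'_i, letting P' be the profile obtained from P by replacing P_i with P'_i, one has cost(P') − cost(P) = cost_{P'}(P'_i) − cost_P(P_i), i.e., the change in total cost equals the change in agent i's individual cost. -/
/-- A mixed graph: a set `E` of undirected edges (non-diagonal `Sym2`s) and
a set `A` of arcs (ordered pairs of distinct vertices). -/
structure MixedGraph (V : Type*) where
  E : Finset (Sym2 V)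
  A : Finset (V × V)
  not_diag : ∀ e ∈ E, ¬ e.IsDiag
  arc_ne : ∀ a ∈ A, a.1 ≠ a.2

variable {V : Type*} [DecidableEq V]

/-- One step of a path: along an undirected edge or along an arc (in its direction). -/
def MixedGraph.Step (G : MixedGraph V) (u v : V) : Prop :=
  s(u, v) ∈ G.E ∨ (u, v) ∈ G.A

instance (G : MixedGraph V) : DecidableRel G.Step :=
  fun _ _ => inferInstanceAs (Decidable (_ ∨ _))

/-- `G.IsPath s t P`: `P` is a path from `s` to `t` in the mixed graph `G`:
a sequence of pairwise distinct vertices starting at `s`, ending at `t`, each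
consecutive step being along an edge or an arc in its direction. -/
def MixedGraph.IsPath (G : MixedGraph V) (s t : V) (P : List V) : Prop :=
  P.Nodup ∧ P.head? = some s ∧ P.getLast? = some t ∧ P.Chain' G.Step

/-- `traverses P u v`: the path `P` moves from `u` directly to `v`. -/
def traverses (P : List V) (u v : V) : Prop := (u, v) ∈ P.zip P.tail

instance (P : List V) (u v : V) : Decidable (traverses P u v) :=
  inferInstanceAs (Decidable ((u, v) ∈ P.zip P.tail))

/-- 0/1 indicator of `traverses P u v`. -/
def dirInd (P : List V) (u v : V) : ℕ := if traverses P u v then 1 else 0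

variable {ι : Type*} [Fintype ι] [DecidableEq ι]

/-- `x_{(u,v)}`: the number of agents whose path traverses the edge `{u,v}` from `u` to `v`. -/
def dirCount (P : ι → List V) (u v : V) : ℕ :=
  (Finset.univ.filter fun i => traverses (P i) u v).card

/-- The total cost `Σ_{e={u,v} ∈ E} w_e · x_{(u,v)} · x_{(v,u)}` of a strategy profile. -/
def MixedGraph.totalCost (G : MixedGraph V) (w : Sym2 V → ℕ) (P : ι → List V) : ℕ :=
  ∑ e ∈ G.E, Sym2.lift ⟨fun u v => w s(u, v) * (dirCount P u v * dirCount P v u),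
    by intro a b; dsimp only; rw [show s(b, a) = s(a, b) from Sym2.eq_swap]; ring⟩ e

/-- The crossing cost of two paths: the sum of `w_e` over edges `e ∈ E` that the
two paths traverse in opposite directions. -/
def MixedGraph.crossCost (G : MixedGraph V) (w : Sym2 V → ℕ) (P Q : List V) : ℕ :=
  ∑ e ∈ G.E, Sym2.lift ⟨fun u v =>
      w s(u, v) * (dirInd P u v * dirInd Q v u + dirInd P v u * dirInd Q u v),
    by intro a b; dsimp only; rw [show s(b, a) = s(a, b) from Sym2.eq_swap]; ring⟩ e

/-- Number of agents other than `i` traversing from `u` to `v`. -/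
def oppCount (P : ι → List V) (i : ι) (u v : V) : ℕ :=
  (Finset.univ.filter fun j => j ≠ i ∧ traverses (P j) u v).card

/-- The individual cost of agent `i`: for each edge `e` traversed by `P i`,
`w_e` times the number of other agents traversing `e` in the opposite direction. -/
def MixedGraph.indivCost (G : MixedGraph V) (w : Sym2 V → ℕ) (P : ι → List V) (i : ι) : ℕ :=
  ∑ e ∈ G.E, Sym2.lift ⟨fun u v =>
      w s(u, v) * (dirInd (P i) u v * oppCount P i v u + dirInd (P i) v u * oppCount P i u v),
    by intro a b; dsimp only; rw [show s(b, a) = s(a, b) from Sym2.eq_swap]; ring⟩ e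

/-- A strategy profile: for each terminal pair `T i = (sᵢ, tᵢ)`, an `sᵢ`–`tᵢ` path. -/
def MixedGraph.IsProfile (G : MixedGraph V) (T : ι → V × V) (P : ι → List V) : Prop :=
  ∀ i, G.IsPath (T i).1 (T i).2 (P i)

/-- A pure Nash equilibrium: no agent can strictly decrease its individual cost
by unilaterally switching to another path between its terminals. -/
def MixedGraph.IsNash (G : MixedGraph V) (w : Sym2 V → ℕ) (T : ι → V × V)
    (P : ι → List V) : Prop :=
  ∀ i (P' : List V), G.IsPath (T i).1 (T i).2 P' →
    G.indivCost w P i ≤ G.indivCost w (Function.update P i P') i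

/-- A path without repeated vertices does not traverse an edge in both directions. -/
theorem not_traverses_swap_of_nodup {P : List V} (hP : P.Nodup) {u v : V}
    (huv : traverses P u v) : ¬ traverses P v u := by
  intro hvu
  obtain ⟨n, hn, hn'⟩ := List.mem_iff_getElem.mp huv
  obtain ⟨m, hm, hm'⟩ := List.mem_iff_getElem.mp hvu
  simp only [List.length_zip, List.length_tail] at hn hm
  simp only [List.getElem_zip, List.getElem_tail, Prod.mk.injEq] at hn' hm'
  have h₁ := (hP.getElem_inj_iff).mp (hn'.1.trans hm'.2.symm)
  have h₂ := (hP.getElem_inj_iff).mp (hn'.2.trans hm'.1.symm)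
  omega

theorem dirInd_mul_dirInd_swap_of_nodup {P : List V} (hP : P.Nodup) (u v : V) :
    dirInd P u v * dirInd P v u = 0 := by
  by_cases h : traverses P u v
  · simp [dirInd, not_traverses_swap_of_nodup hP h]
  · simp [dirInd, h]

theorem dirCount_eq_dirInd_add_oppCount (P : ι → List V) (i : ι) (u v : V) :
    dirCount P u v = dirInd (P i) u v + oppCount P i u v := by
  simp only [dirCount, oppCount, dirInd, Finset.card_filter]
  rw [← Finset.add_sum_erase _ _ (Finset.mem_univ i),
    ← Finset.add_sum_erase _ (fun j => if j ≠ i ∧ _ then 1 else 0) (Finset.mem_univ i)]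
  simp only [ne_eq, not_true_eq_false, false_and, if_false, zero_add]
  congr 1
  refine Finset.sum_congr rfl fun j hj => ?_
  simp [Finset.ne_of_mem_erase hj]

theorem oppCount_update (P : ι → List V) (i : ι) (Q : List V) (u v : V) :
    oppCount (Function.update P i Q) i u v = oppCount P i u v := by
  unfold oppCount
  congr 1
  refine Finset.filter_congr fun j _ => and_congr_right fun hj => ?_
  rw [Function.update_of_ne hj]

/-- The part of the total cost that does not involve agent `i`. -/
def MixedGraph.othersCost (G : MixedGraph V) (w : Sym2 V → ℕ) (P : ι → List V) (i : ι) : ℕ :=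
  ∑ e ∈ G.E, Sym2.lift ⟨fun u v => w s(u, v) * (oppCount P i u v * oppCount P i v u),
    by intro a b; dsimp only; rw [show s(b, a) = s(a, b) from Sym2.eq_swap]; ring⟩ e

theorem MixedGraph.othersCost_update (G : MixedGraph V) (w : Sym2 V → ℕ) (P : ι → List V)
    (i : ι) (Q : List V) :
    G.othersCost w (Function.update P i Q) i = G.othersCost w P i := by
  simp only [MixedGraph.othersCost, oppCount_update]

theorem MixedGraph.totalCost_eq_indivCost_add_othersCost (G : MixedGraph V) (w : Sym2 V → ℕ)
    (P : ι → List V) (i : ι) (hP : (P i).Nodup) :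
    G.totalCost w P = G.indivCost w P i + G.othersCost w P i := by
  simp only [MixedGraph.totalCost, MixedGraph.indivCost, MixedGraph.othersCost,
    ← Finset.sum_add_distrib]
  refine Finset.sum_congr rfl fun e _ => ?_
  induction e using Sym2.ind with
  | _ u v =>
    simp only [Sym2.lift_mk, dirCount_eq_dirInd_add_oppCount P i]
    linear_combination w s(u, v) * dirInd_mul_dirInd_swap_of_nodup hP u v

/-- the total cost is an exact potential function: a unilateral
deviation changes the total cost by exactly the change of the deviator's
individual cost. -/
theorem stmt1 {k : ℕ} (G : MixedGraph V) (w : Sym2 V → ℕ) (hw : ∀ e ∈ G.E, 0 < w e)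
    (T : Fin k → V × V) (hT : ∀ i, (T i).1 ≠ (T i).2)
    (P : Fin k → List V) (hP : G.IsProfile T P)
    (i : Fin k) (P' : List V) (hP' : G.IsPath (T i).1 (T i).2 P') :
    (G.totalCost w (Function.update P i P') : ℤ) - (G.totalCost w P : ℤ) =
      (G.indivCost w (Function.update P i P') i : ℤ) - (G.indivCost w P i : ℤ) := by
  rw [G.totalCost_eq_indivCost_add_othersCost w P i (hP i).1,
    G.totalCost_eq_indivCost_add_othersCost w (Function.update P i P') i
      (by rw [Function.update_self]; exact hP'.1),
    G.othersCost_update]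
  push_cast
  ring
end

section
/- The price of anarchy of CC-MAR is unbounded. Concretely, let G be the complete undirected graph on vertices {a, b, c} with unit edge weights and no arcs, and let the six terminal pairs be (a,b), (a,c), (b,c), (b,a), (c,a), (c,b). Then the profile P₁ in which each agent uses the single-edge direct path (a–b, a–c, b–c, b–a, c–a, c–b) is a pure Nash equilibrium in which every agent has individual cost 1 (so P₁ has strictly positive total cost), while the profile P₂ = (a–b, a–b–c, b–c, b–c–a, c–a, c–a–b) has total cost 0; hence the minimum total cost of this instance is 0. -/
variable {V : Type*} [DecidableEq V]

variable {ι : Type*} [Fintype ι] [DecidableEq ι]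

/-- The triangle: complete undirected graph on three vertices, no arcs. -/
def G3 : MixedGraph (Fin 3) where
  E := {s(0, 1), s(0, 2), s(1, 2)}
  A := ∅
  not_diag := by decide
  arc_ne := by simp

/-- Unit edge weights. -/
def w3 : Sym2 (Fin 3) → ℕ := fun _ => 1

/-- The six terminal pairs (a,b), (a,c), (b,c), (b,a), (c,a), (c,b). -/
def T6 : Fin 6 → Fin 3 × Fin 3 := ![(0, 1), (0, 2), (1, 2), (1, 0), (2, 0), (2, 1)]

/-- The profile P₁ of single-edge direct paths. -/
def Pone : Fin 6 → List (Fin 3) := ![[0, 1], [0, 2], [1, 2], [1, 0], [2, 0], [2, 1]]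

/-- The profile P₂ = (a–b, a–b–c, b–c, b–c–a, c–a, c–a–b). -/
def Ptwo : Fin 6 → List (Fin 3) := ![[0, 1], [0, 1, 2], [1, 2], [1, 2, 0], [2, 0], [2, 0, 1]]

instance (G : MixedGraph V) (s t : V) (P : List V) :
    Decidable (G.IsPath s t P) :=
  inferInstanceAs (Decidable (P.Nodup ∧ P.head? = some s ∧ P.getLast? = some t ∧
    List.IsChain G.Step P))

/-- A property of lists over `Fin 3` that holds for all lists of length at most three
holds for every list without duplicates. -/
theorem forall_nodup_fin_three {p : List (Fin 3) → Prop} (h0 : p []) (h1 : ∀ x, p [x])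
    (h2 : ∀ x y, p [x, y]) (h3 : ∀ x y z, p [x, y, z]) (l : List (Fin 3)) (hl : l.Nodup) :
    p l := by
  have hlen : l.length ≤ 3 := by simpa using hl.length_le_card
  match l, hlen with
  | [], _ => exact h0
  | [x], _ => exact h1 x
  | [x, y], _ => exact h2 x y
  | [x, y, z], _ => exact h3 x y z
  | _ :: _ :: _ :: _ :: _, h => exact absurd h (by simp only [List.length_cons]; omega)

theorem isProfile_Pone : G3.IsProfile T6 Pone := by
  unfold MixedGraph.IsProfile
  decide +kernel

theorem isProfile_Ptwo : G3.IsProfile T6 Ptwo := by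
  unfold MixedGraph.IsProfile
  decide +kernel

theorem totalCost_Ptwo : G3.totalCost w3 Ptwo = 0 := by
  decide +kernel

theorem isNash_Pone : G3.IsNash w3 T6 Pone := by
  intro i P' hP'
  refine forall_nodup_fin_three (p := fun l => ∀ i, G3.IsPath (T6 i).1 (T6 i).2 l →
    G3.indivCost w3 Pone i ≤ G3.indivCost w3 (Function.update Pone i l) i)
    ?_ ?_ ?_ ?_ P' hP'.1 i hP' <;> decide +kernel

/-- the price of anarchy of CC-MAR is unbounded: on the triangle with
unit weights and the six terminal pairs above, `P₁` is a strategy profile that is a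
pure Nash equilibrium in which every agent has individual cost 1 (so its total cost
is strictly positive), while `P₂` is a strategy profile of total cost 0; hence the
minimum total cost of this instance is 0. -/
theorem stmt6 :
    G3.IsProfile T6 Pone ∧ G3.IsNash w3 T6 Pone ∧
    (∀ i : Fin 6, G3.indivCost w3 Pone i = 1) ∧
    0 < G3.totalCost w3 Pone ∧
    G3.IsProfile T6 Ptwo ∧ G3.totalCost w3 Ptwo = 0 ∧
    (∀ P : Fin 6 → List (Fin 3), G3.IsProfile T6 P →
      G3.totalCost w3 Ptwo ≤ G3.totalCost w3 P) := by
  exact ⟨isProfile_Pone, isNash_Pone, by decide +kernel, by decide +kernel, isProfile_Ptwo,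
    totalCost_Ptwo, fun P _ => totalCost_Ptwo ▸ Nat.zero_le _⟩
end
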